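/- arXiv:1206.3763 — 2 statements merged into one kernel-verified Lean document; each statement's English description precedes it below -/
import Mathlib

section
/- Let M be a p×n random matrix with independent entries, and let A be the n×n matrix with A_{ij}=F(M_i,M_j,p), where M_i denotes the i-th column of M and F:ℝ^p×ℝ^p×ℝ→ℝ is measurable, real-valued and symmetric in its first two variables. Then for every complex z with Im z>0 there is a constant C depending only on Im z (one may take C=C_0/(Im z)^4 for an absolute constant C_0) such that E|m_A(z)−E m_A(z)|^4 ≤ C·n^{−2}. -/
open MeasureTheory ProbabilityTheory Filter Matrix

/-- Stieltjes transform of an `n × n` real matrix: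
`m_M(z) = n⁻¹ · Tr((M − z·I)⁻¹)`. -/
noncomputable def stieltjesTransform {n : ℕ} (M : Matrix (Fin n) (Fin n) ℝ) (z : ℂ) : ℂ :=
  (n : ℂ)⁻¹ * ((M.map (fun x : ℝ => (x : ℂ)) - z • (1 : Matrix (Fin n) (Fin n) ℂ))⁻¹).trace


theorem aux_norm_trace_le {E : Type*} [NormedAddCommGroup E] [InnerProductSpace ℂ E]
    [FiniteDimensional ℂ E] (T : E →ₗ[ℂ] E) (W : Submodule ℂ E) (hW : ∀ x, T x ∈ W)
    (K : ℝ) (hT : ∀ x, ‖T x‖ ≤ K * ‖x‖) :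
    ‖LinearMap.trace ℂ E T‖ ≤ Module.finrank ℂ W * K := by
  rw [← LinearMap.trace_restrict_eq_of_forall_mem W T hW,
    LinearMap.trace_eq_sum_inner _ (stdOrthonormalBasis ℂ W)]
  refine (norm_sum_le _ _).trans ?_
  have : ∀ i ∈ Finset.univ, ‖inner ℂ ((stdOrthonormalBasis ℂ W) i)
      ((T.restrict (fun x _ => hW x)) ((stdOrthonormalBasis ℂ W) i))‖ ≤ K := by
    intro i _
    refine (norm_inner_le_norm _ _).trans ?_
    have h1 : ‖(stdOrthonormalBasis ℂ W) i‖ = 1 := (stdOrthonormalBasis ℂ W).norm_eq_one i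
    rw [h1, one_mul]
    have h2 := hT ((stdOrthonormalBasis ℂ W) i : E)
    rw [Submodule.coe_norm] at h1
    rw [h1, mul_one] at h2
    exact h2
  refine (Finset.sum_le_sum this).trans ?_
  simp

theorem aux_trace_toEuclideanLin {n : ℕ} (B : Matrix (Fin n) (Fin n) ℂ) :
    LinearMap.trace ℂ _ (toEuclideanLin B) = B.trace := by
  rw [LinearMap.trace_eq_sum_inner _ (EuclideanSpace.basisFun (Fin n) ℂ)]
  simp [Matrix.trace, toLpLin_apply, EuclideanSpace.inner_single_left]

/-- the shifted matrix -/
noncomputable def auxShift {n : ℕ} (M : Matrix (Fin n) (Fin n) ℝ) (z : ℂ) :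
    Matrix (Fin n) (Fin n) ℂ :=
  M.map (fun x : ℝ => (x : ℂ)) - z • (1 : Matrix (Fin n) (Fin n) ℂ)

theorem aux_lower {n : ℕ} (M : Matrix (Fin n) (Fin n) ℝ) (hM : ∀ i j, M i j = M j i)
    (z : ℂ) (hz : 0 < z.im) (v : EuclideanSpace ℂ (Fin n)) :
    z.im * ‖v‖ ≤ ‖toEuclideanLin (auxShift M z) v‖ := by
  have hH : (M.map (fun x : ℝ => (x : ℂ))).IsHermitian := by
    ext i j
    simp [hM i j]
  have hS := isSymmetric_toEuclideanLin_iff.2 hH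
  have h0 : (inner ℂ (toEuclideanLin (M.map (fun x : ℝ => (x : ℂ))) v) v).im = 0 :=
    hS.im_inner_apply_self v
  have h1 : toEuclideanLin (auxShift M z) v
      = toEuclideanLin (M.map (fun x : ℝ => (x : ℂ))) v - z • v := by
    simp [auxShift, map_sub]
  have h2 : (inner ℂ (toEuclideanLin (auxShift M z) v) v).im = z.im * ‖v‖ ^ 2 := by
    rw [h1, inner_sub_left, Complex.sub_im, h0, inner_smul_left, inner_self_eq_norm_sq_to_K]
    norm_cast
    simp
    simp [← Complex.ofReal_pow]
  have h3 : z.im * ‖v‖ ^ 2 ≤ ‖toEuclideanLin (auxShift M z) v‖ * ‖v‖ := by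
    rw [← h2]
    exact (Complex.im_le_norm _).trans (norm_inner_le_norm _ _)
  rcases (norm_nonneg v).eq_or_lt with h | h
  · rw [← h]; simp
  · nlinarith

theorem aux_isUnit {n : ℕ} (M : Matrix (Fin n) (Fin n) ℝ) (hM : ∀ i j, M i j = M j i)
    (z : ℂ) (hz : 0 < z.im) : IsUnit (auxShift M z).det := by
  rw [← isUnit_iff_isUnit_det, ← mulVec_injective_iff_isUnit]
  have : Function.Injective (toEuclideanLin (auxShift M z)) := by
    rw [← LinearMap.ker_eq_bot, LinearMap.ker_eq_bot']
    intro v hv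
    have := aux_lower M hM z hz v
    rw [hv, norm_zero] at this
    have h2 := norm_nonneg v
    have : ‖v‖ = 0 := by nlinarith
    simpa using this
  intro x y hxy
  have h := @this (WithLp.toLp 2 x) (WithLp.toLp 2 y) (by simp [toLpLin_apply, hxy])
  simpa using h

theorem aux_inv_bound {n : ℕ} (M : Matrix (Fin n) (Fin n) ℝ) (hM : ∀ i j, M i j = M j i)
    (z : ℂ) (hz : 0 < z.im) (v : EuclideanSpace ℂ (Fin n)) :
    ‖toEuclideanLin (auxShift M z)⁻¹ v‖ ≤ z.im⁻¹ * ‖v‖ := by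
  have h := aux_lower M hM z hz (toEuclideanLin (auxShift M z)⁻¹ v)
  have h2 : toEuclideanLin (auxShift M z) (toEuclideanLin (auxShift M z)⁻¹ v) = v := by
    simp [toLpLin_apply, mul_nonsing_inv _ (aux_isUnit M hM z hz)]
  rw [h2] at h
  rw [inv_mul_eq_div, le_div_iff₀ hz, mul_comm]
  exact h

theorem aux_trace_bound {n : ℕ} (M : Matrix (Fin n) (Fin n) ℝ) (hM : ∀ i j, M i j = M j i)
    (z : ℂ) (hz : 0 < z.im) : ‖((auxShift M z)⁻¹).trace‖ ≤ n * z.im⁻¹ := by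
  rw [← aux_trace_toEuclideanLin]
  have := aux_norm_trace_le (toEuclideanLin (auxShift M z)⁻¹) ⊤ (fun _ => trivial) _
    (aux_inv_bound M hM z hz)
  simpa using this

theorem aux_trace_diff {n : ℕ} (M N : Matrix (Fin n) (Fin n) ℝ) (hM : ∀ i j, M i j = M j i)
    (hN : ∀ i j, N i j = N j i) (k : Fin n) (hMN : ∀ i j, i ≠ k → j ≠ k → M i j = N i j)
    (z : ℂ) (hz : 0 < z.im) :
    ‖((auxShift M z)⁻¹).trace - ((auxShift N z)⁻¹).trace‖ ≤ 4 * z.im⁻¹ := by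
  rw [← aux_trace_toEuclideanLin, ← aux_trace_toEuclideanLin, ← map_sub]
  set R := (auxShift M z)⁻¹ with hR
  set R' := (auxShift N z)⁻¹ with hR'
  set D := auxShift N z - auxShift M z with hD
  have hres : R - R' = R * D * R' := by
    rw [hD, mul_sub, sub_mul, hR, hR', nonsing_inv_mul _ (aux_isUnit M hM z hz), one_mul,
      mul_assoc, mul_nonsing_inv _ (aux_isUnit N hN z hz), mul_one]
  have hD0 : ∀ i j, i ≠ k → j ≠ k → D i j = 0 := by
    intro i j hi hj
    simp [hD, auxShift, hMN i j hi hj]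
  have hDv : ∀ w : Fin n → ℂ, ∃ a b : ℂ,
      D *ᵥ w = a • (fun i => D i k) + b • Pi.single k 1 := by
    intro w
    refine ⟨w k, (D *ᵥ w) k - w k * D k k, ?_⟩
    ext i
    by_cases hi : i = k
    · subst hi; simp
    · simp only [Pi.add_apply, Pi.smul_apply, smul_eq_mul, Pi.single_apply, hi, if_false]
      rw [mulVec, dotProduct, Finset.sum_eq_single k]
      · ring
      · intro j _ hj; rw [hD0 i j hi hj, zero_mul]
      · simp
  let W : Submodule ℂ (EuclideanSpace ℂ (Fin n)) :=
    Submodule.span ℂ (({WithLp.toLp 2 (R *ᵥ (fun i => D i k)),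
      WithLp.toLp 2 (R *ᵥ Pi.single k 1)} : Finset (EuclideanSpace ℂ (Fin n))) : Set _)
  have hW : Module.finrank ℂ W ≤ 2 :=
    (finrank_span_finset_le_card _).trans Finset.card_le_two
  have key := aux_norm_trace_le (toEuclideanLin R - toEuclideanLin R') W (fun x => by
    rw [← map_sub, hres, toLpLin_apply, ← mulVec_mulVec, ← mulVec_mulVec]
    obtain ⟨a, b, hab⟩ := hDv (R' *ᵥ x.ofLp)
    rw [hab, mulVec_add, mulVec_smul, mulVec_smul, WithLp.toLp_add, WithLp.toLp_smul,
      WithLp.toLp_smul]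
    exact W.add_mem (W.smul_mem _ (Submodule.subset_span (by simp)))
      (W.smul_mem _ (Submodule.subset_span (by simp)))) (2 * z.im⁻¹) (fun x => by
    rw [LinearMap.sub_apply]
    refine (norm_sub_le _ _).trans ?_
    linarith [aux_inv_bound M hM z hz x, aux_inv_bound N hN z hz x])
  refine key.trans ?_
  have h2 : (Module.finrank ℂ W : ℝ) ≤ 2 := by exact_mod_cast hW
  have h3 : 0 < z.im⁻¹ := inv_pos.2 hz
  nlinarith

theorem aux_poly4 (s d c : ℝ) (hd : |d| ≤ c) :
    (s + d) ^ 4 ≤ s ^ 4 + 4 * s ^ 3 * d + 8 * c ^ 2 * s ^ 2 + 3 * c ^ 4 := by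
  have h1 : d ^ 2 ≤ c ^ 2 := by
    rw [← sq_abs d]; exact pow_le_pow_left₀ (abs_nonneg _) hd 2
  have h2 : d ^ 4 ≤ c ^ 4 := by nlinarith [sq_nonneg d, sq_nonneg c]
  nlinarith [mul_le_mul_of_nonneg_left h1 (sq_nonneg s), sq_nonneg (d * (s - d))]

theorem aux_poly2 (s d c : ℝ) (hd : |d| ≤ c) :
    (s + d) ^ 2 ≤ s ^ 2 + 2 * s * d + c ^ 2 := by
  have h1 : d ^ 2 ≤ c ^ 2 := by
    rw [← sq_abs d]; exact pow_le_pow_left₀ (abs_nonneg _) hd 2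
  nlinarith

theorem aux_int {α : Type*} [MeasurableSpace α] (μ : Measure α) [IsProbabilityMeasure μ]
    {f : α → ℝ} (hf : Measurable f) {B : ℝ} (hB : ∀ x, |f x| ≤ B) : Integrable f μ :=
  Integrable.of_bound hf.aestronglyMeasurable B (ae_of_all _ hB)

theorem aux_int_bound {α : Type*} [MeasurableSpace α] (μ : Measure α) [IsProbabilityMeasure μ]
    {f : α → ℝ} {B : ℝ} (hB : ∀ x, |f x| ≤ B) : |∫ x, f x ∂μ| ≤ B := by
  have := norm_integral_le_of_norm_le_const (μ := μ) (f := f) (ae_of_all _ hB)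
  simpa using this

/-- one step of tensorization -/
theorem aux_step {X Y : Type*} [MeasurableSpace X] [MeasurableSpace Y]
    (μ : Measure X) (ν : Measure Y) [IsProbabilityMeasure μ] [IsProbabilityMeasure ν]
    (f : X × Y → ℝ) (hf : Measurable f) (B : ℝ) (hB : ∀ x, |f x| ≤ B) (c : ℝ)
    (hc : ∀ x x' y, |f (x, y) - f (x', y)| ≤ c) (m : ℝ) :
    (∫ q, (f q - m) ^ 2 ∂(μ.prod ν) ≤ ∫ y, ((∫ x, f (x, y) ∂μ) - m) ^ 2 ∂ν + c ^ 2) ∧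
    (∫ q, (f q - m) ^ 4 ∂(μ.prod ν) ≤ ∫ y, ((∫ x, f (x, y) ∂μ) - m) ^ 4 ∂ν
      + 8 * c ^ 2 * ∫ y, ((∫ x, f (x, y) ∂μ) - m) ^ 2 ∂ν + 3 * c ^ 4) := by
  set g : Y → ℝ := fun y => ∫ x, f (x, y) ∂μ with hg
  have hgm : Measurable g := by
    have : StronglyMeasurable (fun q : Y × X => f (q.2, q.1)) :=
      (hf.comp measurable_swap).stronglyMeasurable
    exact this.integral_prod_right'.measurable
  have hgB : ∀ y, |g y| ≤ B := fun y => aux_int_bound μ (fun x => hB (x, y))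
  have hfy : ∀ y, Integrable (fun x => f (x, y)) μ := fun y =>
    aux_int μ (hf.comp (by fun_prop)) (fun x => hB (x, y))
  have hd : ∀ x y, |f (x, y) - g y| ≤ c := by
    intro x y
    have : f (x, y) - g y = ∫ x', (f (x, y) - f (x', y)) ∂μ := by
      rw [integral_sub (integrable_const _) (hfy y)]; simp [hg]
    rw [this]
    exact aux_int_bound μ (fun x' => hc x x' y)
  have hsB : ∀ y, |g y - m| ≤ B + |m| := fun y =>
    (abs_sub _ _).trans (by linarith [hgB y])
  have hfB : ∀ q, |f q - m| ≤ B + |m| := fun y =>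
    (abs_sub _ _).trans (by linarith [hB y])
  have hpow : ∀ k : ℕ, Integrable (fun y => (g y - m) ^ k) ν := fun k =>
    aux_int ν (by fun_prop) (B := (B + |m|) ^ k) (fun y => by
      rw [abs_pow]; exact pow_le_pow_left₀ (abs_nonneg _) (hsB y) k)
  have hfpow : ∀ k : ℕ, Integrable (fun q => (f q - m) ^ k) (μ.prod ν) := fun k =>
    aux_int _ (by fun_prop) (B := (B + |m|) ^ k) (fun y => by
      rw [abs_pow]; exact pow_le_pow_left₀ (abs_nonneg _) (hfB y) k)
  have hd0 : ∀ y, ∫ x, (f (x, y) - g y) ∂μ = 0 := by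
    intro y
    rw [integral_sub (hfy y) (integrable_const _)]; simp [hg]
  have hdi : ∀ y, Integrable (fun x => f (x, y) - g y) μ := fun y =>
    (hfy y).sub (integrable_const _)
  have hfpowy : ∀ (k : ℕ) y, Integrable (fun x => (f (x, y) - m) ^ k) μ := fun k y =>
    aux_int _ ((hf.comp (by fun_prop : Measurable (fun x : X => (x, y)))).sub_const m |>.pow_const k)
      (B := (B + |m|) ^ k) (fun x => by
      rw [abs_pow]; exact pow_le_pow_left₀ (abs_nonneg _) (hfB _) k)
  constructor
  · rw [integral_prod_symm _ (hfpow 2)]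
    have hb : ∀ y, ∫ x, (f (x, y) - m) ^ 2 ∂μ ≤ (g y - m) ^ 2 + c ^ 2 := by
      intro y
      calc ∫ x, (f (x, y) - m) ^ 2 ∂μ
          ≤ ∫ x, (((g y - m) ^ 2 + c ^ 2) + 2 * (g y - m) * (f (x, y) - g y)) ∂μ := by
            refine integral_mono (hfpowy 2 y)
              ((integrable_const _).add ((hdi y).const_mul _)) (fun x => ?_)
            have := aux_poly2 (g y - m) (f (x, y) - g y) c (hd x y)
            simp only [sub_add_sub_cancel'] at this
            have e : g y - m + (f (x, y) - g y) = f (x, y) - m := by ring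
            simp only
            nlinarith
        _ = _ := by
            rw [integral_add (integrable_const _) ((hdi y).const_mul _),
              integral_const_mul, hd0]
            simp
    calc _ ≤ ∫ y, ((g y - m) ^ 2 + c ^ 2) ∂ν :=
          integral_mono (hfpow 2).integral_prod_right ((hpow 2).add (integrable_const _)) hb
      _ = _ := by
          rw [integral_add (hpow 2) (integrable_const _)]; simp [hg]
  · rw [integral_prod_symm _ (hfpow 4)]
    have hb : ∀ y, ∫ x, (f (x, y) - m) ^ 4 ∂μ
        ≤ ((g y - m) ^ 4 + 8 * c ^ 2 * (g y - m) ^ 2) + 3 * c ^ 4 := by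
      intro y
      calc ∫ x, (f (x, y) - m) ^ 4 ∂μ
          ≤ ∫ x, (((g y - m) ^ 4 + 8 * c ^ 2 * (g y - m) ^ 2 + 3 * c ^ 4)
              + 4 * (g y - m) ^ 3 * (f (x, y) - g y)) ∂μ := by
            refine integral_mono (hfpowy 4 y)
              ((integrable_const _).add ((hdi y).const_mul _)) (fun x => ?_)
            have := aux_poly4 (g y - m) (f (x, y) - g y) c (hd x y)
            have e : g y - m + (f (x, y) - g y) = f (x, y) - m := by ring
            rw [e] at this
            simp only
            linarith
        _ = _ := by
            rw [integral_add (integrable_const _) ((hdi y).const_mul _),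
              integral_const_mul, hd0]
            simp
    calc _ ≤ ∫ y, (((g y - m) ^ 4 + 8 * c ^ 2 * (g y - m) ^ 2) + 3 * c ^ 4) ∂ν :=
          integral_mono (hfpow 4).integral_prod_right
            (((hpow 4).add ((hpow 2).const_mul _)).add (integrable_const _)) hb
      _ = _ := by
          have hi : Integrable (fun y => (g y - m) ^ 4 + 8 * c ^ 2 * (g y - m) ^ 2) ν :=
            (hpow 4).add ((hpow 2).const_mul _)
          rw [integral_add hi (integrable_const _),
            integral_add (hpow 4) ((hpow 2).const_mul _), integral_const_mul]; simp [hg]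

/-- fourth moment under bounded differences -/
theorem aux_bdd_diff {E : Type*} [MeasurableSpace E] (c B : ℝ) : ∀ (n : ℕ)
    (μ : Fin n → Measure E) [∀ i, IsProbabilityMeasure (μ i)] (f : (Fin n → E) → ℝ),
    Measurable f → (∀ x, |f x| ≤ B) →
    (∀ x k y, |f x - f (Function.update x k y)| ≤ c) →
    (∫ x, (f x - ∫ x', f x' ∂(Measure.pi μ)) ^ 2 ∂(Measure.pi μ) ≤ n * c ^ 2) ∧
    (∫ x, (f x - ∫ x', f x' ∂(Measure.pi μ)) ^ 4 ∂(Measure.pi μ) ≤ 4 * (n : ℝ) ^ 2 * c ^ 4) := by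
  intro n
  induction n with
  | zero =>
    intro μ _ f hf hB hc
    have : ∀ x, f x = f default := fun x => congrArg f (Subsingleton.elim _ _)
    simp [this]
  | succ n ih =>
    intro μ _ f hf hB hc
    let e := MeasurableEquiv.piFinSuccAbove (fun _ : Fin (n + 1) => E) 0
    let ν : Fin n → Measure E := fun j => μ ((0 : Fin (n + 1)).succAbove j)
    have he : MeasurePreserving e (Measure.pi μ) ((μ 0).prod (Measure.pi ν)) :=
      measurePreserving_piFinSuccAbove μ 0
    have hes := he.symm
    let f' : E × (Fin n → E) → ℝ := fun q => f (e.symm q)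
    have hf' : Measurable f' := hf.comp e.symm.measurable
    have hecons : ∀ q, e.symm q = Fin.cons q.1 q.2 := by
      intro q
      simp [e, MeasurableEquiv.piFinSuccAbove, Fin.consEquiv]
    have tr : ∀ g : ℝ → ℝ, ∫ x, g (f x) ∂(Measure.pi μ) = ∫ q, g (f' q) ∂((μ 0).prod (Measure.pi ν)) := by
      intro g
      exact (hes.integral_comp' (f := e.symm) (fun x => g (f x))).symm
    let h : (Fin n → E) → ℝ := fun y => ∫ x, f' (x, y) ∂(μ 0)
    have hf'y : ∀ y, Integrable (fun x => f' (x, y)) (μ 0) := fun y =>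
      aux_int _ (hf'.comp (by fun_prop)) (fun x => hB _)
    have hh : Measurable h := by
      have : StronglyMeasurable (fun q : (Fin n → E) × E => f' (q.2, q.1)) :=
        (hf'.comp measurable_swap).stronglyMeasurable
      exact this.integral_prod_right'.measurable
    have hhB : ∀ y, |h y| ≤ B := fun y => aux_int_bound _ (fun x => hB _)
    have hhc : ∀ y k w, |h y - h (Function.update y k w)| ≤ c := by
      intro y k w
      simp only [h]
      rw [← integral_sub (hf'y _) (hf'y _)]
      refine aux_int_bound _ (fun x => ?_)
      have := hc (e.symm (x, y)) k.succ w
      simp only [f']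
      rw [hecons, hecons] at *
      simpa [Fin.cons_update] using this
    have hm : ∫ x, f x ∂(Measure.pi μ) = ∫ y, h y ∂(Measure.pi ν) := by
      rw [tr (fun t => t), integral_prod_symm _ (aux_int _ hf' (fun x => hB _))]
    have hc' : ∀ x x' y, |f' (x, y) - f' (x', y)| ≤ c := by
      intro x x' y
      have := hc (e.symm (x, y)) 0 x'
      simp only [f']
      rw [hecons, hecons] at *
      simpa [Fin.update_cons_zero] using this
    obtain ⟨i2, i4⟩ := ih ν h hh hhB hhc
    rw [← hm] at i2 i4
    set m := ∫ x, f x ∂(Measure.pi μ)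
    obtain ⟨s2, s4⟩ := aux_step (μ 0) (Measure.pi ν) f' hf' B (fun q => hB _) c hc' m
    rw [tr (fun t => (t - m) ^ 2), tr (fun t => (t - m) ^ 4)]
    have s2' := s2
    change _ ≤ ∫ y, (h y - m) ^ 2 ∂(Measure.pi ν) + _ at s2'
    change _ ≤ ∫ y, (h y - m) ^ 4 ∂(Measure.pi ν) + 8 * c ^ 2 * (∫ y, (h y - m) ^ 2 ∂(Measure.pi ν)) + _ at s4
    push_cast
    constructor
    · linarith
    · have := mul_le_mul_of_nonneg_left i2 (by positivity : 0 ≤ 8 * c ^ 2)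
      have h4 : 0 ≤ c ^ 4 := by positivity
      nlinarith

theorem aux_law {Ω : Type} [MeasureSpace Ω] [IsProbabilityMeasure (ℙ : Measure Ω)]
    (p n : ℕ) (M : Ω → Matrix (Fin p) (Fin n) ℝ)
    (hM : ∀ (k : Fin p) (l : Fin n), Measurable (fun ω => M ω k l))
    (hI : iIndepFun (fun kl : Fin p × Fin n => fun ω => M ω kl.1 kl.2) ℙ) :
    ∃ μ : Fin n → Measure (Fin p → ℝ), (∀ i, IsProbabilityMeasure (μ i)) ∧
      MeasurePreserving (fun ω (i : Fin n) (k : Fin p) => M ω k i) ℙ (Measure.pi μ) := by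
  have hprob : ∀ (i : Fin n) (k : Fin p),
      IsProbabilityMeasure ((ℙ : Measure Ω).map (fun ω => M ω k i)) :=
    fun i k => Measure.isProbabilityMeasure_map (hM k i).aemeasurable
  have hI2 : iIndepFun (fun ik : Fin n × Fin p => fun ω => M ω ik.2 ik.1) ℙ :=
    hI.precomp (g := Prod.swap) Prod.swap_injective
  have hmap := (iIndepFun_iff_map_fun_eq_infinitePi_map (fun ik : Fin n × Fin p => hM ik.2 ik.1)).1 hI2
  refine ⟨fun i => Measure.infinitePi fun k => (ℙ : Measure Ω).map (fun ω => M ω k i),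
    fun i => inferInstance, ?_, ?_⟩
  · exact measurable_pi_iff.2 fun i => measurable_pi_iff.2 fun k => hM k i
  · rw [← Measure.infinitePi_eq_pi, ← Measure.infinitePi_map_curry
      (fun i k => (ℙ : Measure Ω).map (fun ω => M ω k i)), ← hmap, Measure.map_map (by fun_prop)]
    · rfl
    · exact measurable_pi_iff.2 fun ik : Fin n × Fin p => hM ik.2 ik.1

theorem aux_measurable {n p : ℕ} (F : (Fin p → ℝ) → (Fin p → ℝ) → ℝ)
    (hF : Measurable (fun v : (Fin p → ℝ) × (Fin p → ℝ) => F v.1 v.2)) (z : ℂ) :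
    Measurable (fun x : Fin n → Fin p → ℝ =>
      stieltjesTransform (Matrix.of fun i j => F (x i) (x j)) z) := by
  have h1 : Measurable (fun Q : Fin n → Fin n → ℝ => stieltjesTransform (Matrix.of Q) z) := by
    unfold stieltjesTransform
    simp_rw [Matrix.inv_def, Matrix.trace_smul, Ring.inverse_eq_inv', smul_eq_mul]
    have hc : Continuous (fun Q : Fin n → Fin n → ℝ =>
        ((Matrix.of Q).map (fun x : ℝ => (x : ℂ)) - z • (1 : Matrix (Fin n) (Fin n) ℂ))) := by
      refine continuous_matrix fun i j => ?_
      simp only [Matrix.sub_apply, Matrix.map_apply, Matrix.of_apply]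
      fun_prop
    exact measurable_const.mul (hc.matrix_det.measurable.inv.mul
      hc.matrix_adjugate.matrix_trace.measurable)
  have h2 : Measurable (fun (x : Fin n → Fin p → ℝ) (i j : Fin n) => F (x i) (x j)) := by
    refine measurable_pi_iff.2 fun i => measurable_pi_iff.2 fun j => ?_
    have h3 : Measurable (fun x : Fin n → Fin p → ℝ => (x i, x j)) :=
      (measurable_pi_apply i).prodMk (measurable_pi_apply j)
    exact hF.comp h3
  exact h1.comp h2

theorem aux_norm_four (w : ℂ) : ‖w‖ ^ 4 ≤ 2 * (w.re ^ 4 + w.im ^ 4) := by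
  have h : ‖w‖ ^ 2 = w.re ^ 2 + w.im ^ 2 := by
    rw [Complex.sq_norm, Complex.normSq_apply]; ring
  have : ‖w‖ ^ 4 = (w.re ^ 2 + w.im ^ 2) ^ 2 := by rw [← h]; ring
  rw [this]
  nlinarith [sq_nonneg (w.re ^ 2 - w.im ^ 2)]

/-- The fourth-moment concentration estimate for the Stieltjes transform: there is an
absolute constant `C₀ > 0` such that for every `p × n` random matrix `M` with independent
entries and every measurable real-valued kernel `F`, symmetric in its first two
variables, the matrix `A` with `A_{ij} = F(M_i, M_j, p)` (`M_i` the `i`-th column)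
satisfies `E|m_A(z) − E m_A(z)|⁴ ≤ (C₀/(Im z)⁴) · n⁻²` for every `z` with `Im z > 0`. -/
theorem stieltjes_transform_fourth_moment_bound :
    ∃ C₀ : ℝ, 0 < C₀ ∧
      ∀ (Ω : Type) [MeasureSpace Ω] [IsProbabilityMeasure (ℙ : Measure Ω)]
        (p n : ℕ) (M : Ω → Matrix (Fin p) (Fin n) ℝ),
        (∀ (k : Fin p) (l : Fin n), Measurable (fun ω => M ω k l)) →
        iIndepFun
          (fun kl : Fin p × Fin n => fun ω => M ω kl.1 kl.2) ℙ →
        ∀ (F : (Fin p → ℝ) → (Fin p → ℝ) → ℝ),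
          Measurable (fun v : (Fin p → ℝ) × (Fin p → ℝ) => F v.1 v.2) →
          (∀ x y, F x y = F y x) →
          ∀ (A : Ω → Matrix (Fin n) (Fin n) ℝ),
            (∀ ω i j, A ω i j = F (fun k => M ω k i) (fun k => M ω k j)) →
            ∀ z : ℂ, 0 < z.im →
              ∫ ω, ‖stieltjesTransform (A ω) z
                  - ∫ ω', stieltjesTransform (A ω') z ∂(ℙ : Measure Ω)‖ ^ 4 ∂(ℙ : Measure Ω)
                ≤ (C₀ / z.im ^ 4) / (n : ℝ) ^ 2 := by
  refine ⟨4096, by norm_num, ?_⟩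
  intro Ω _ _ p n M hM hI F hF hsymm A hA z hz
  obtain ⟨μ, hμ, hX⟩ := aux_law p n M hM hI
  set G : (Fin n → Fin p → ℝ) → ℂ := fun x =>
    stieltjesTransform (Matrix.of fun i j => F (x i) (x j)) z with hG
  have hGm : Measurable G := aux_measurable F hF z
  have hAG : ∀ ω, stieltjesTransform (A ω) z = G (fun i k => M ω k i) := by
    intro ω
    have : A ω = Matrix.of fun i j => F (fun k => M ω k i) (fun k => M ω k j) := by
      ext i j; exact hA ω i j
    rw [this]
  have hGB : ∀ x, ‖G x‖ ≤ z.im⁻¹ := by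
    intro x
    have h := aux_trace_bound (Matrix.of fun i j => F (x i) (x j))
      (fun i j => hsymm _ _) z hz
    have h2 : ‖G x‖ = (n : ℝ)⁻¹ * ‖((auxShift (Matrix.of fun i j => F (x i) (x j)) z)⁻¹).trace‖ := by
      simp [hG, stieltjesTransform, auxShift]
    rw [h2]
    refine (mul_le_mul_of_nonneg_left h (by positivity)).trans ?_
    rcases Nat.eq_zero_or_pos n with h0 | h0
    · subst h0; simpa using hz.le
    · have : (0 : ℝ) < n := by exact_mod_cast h0
      rw [← mul_assoc, inv_mul_cancel₀ this.ne', one_mul]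
  have hGc : ∀ x k y, ‖G x - G (Function.update x k y)‖ ≤ 4 * z.im⁻¹ * (n : ℝ)⁻¹ := by
    intro x k y
    have h := aux_trace_diff (Matrix.of fun i j => F (x i) (x j))
      (Matrix.of fun i j => F (Function.update x k y i) (Function.update x k y j))
      (fun i j => hsymm _ _) (fun i j => hsymm _ _) k (fun i j hi hj => by simp [hi, hj]) z hz
    have h2 : G x - G (Function.update x k y) = (n : ℂ)⁻¹ *
        (((auxShift (Matrix.of fun i j => F (x i) (x j)) z)⁻¹).trace -
        ((auxShift (Matrix.of fun i j => F (Function.update x k y i)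
          (Function.update x k y j)) z)⁻¹).trace) := by
      simp only [hG, stieltjesTransform, auxShift]; ring
    rw [h2, norm_mul, norm_inv, Complex.norm_natCast, mul_comm]
    exact mul_le_mul_of_nonneg_right h (by positivity)
  set c : ℝ := 4 * z.im⁻¹ * (n : ℝ)⁻¹ with hcdef
  have hint : ∀ {V : Type} [NormedAddCommGroup V] [NormedSpace ℝ V] (g : (Fin n → Fin p → ℝ) → V),
      AEStronglyMeasurable g (Measure.pi μ) →
      ∫ ω, g (fun i k => M ω k i) ∂(ℙ : Measure Ω) = ∫ x, g x ∂(Measure.pi μ) := by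
    intro V _ _ g hg
    rw [← hX.map_eq] at hg ⊢
    exact (integral_map hX.measurable.aemeasurable hg).symm
  have hGi : Integrable G (Measure.pi μ) :=
    Integrable.of_bound hGm.aestronglyMeasurable _ (ae_of_all _ hGB)
  simp_rw [hAG]
  rw [hint G hGm.aestronglyMeasurable]
  set m := ∫ x, G x ∂(Measure.pi μ) with hm
  rw [hint (fun x => ‖G x - m‖ ^ 4) (by
    exact ((hGm.sub_const m).norm.pow_const 4).aestronglyMeasurable)]
  have hre : m.re = ∫ x, (G x).re ∂(Measure.pi μ) := (integral_re hGi).symm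
  have him : m.im = ∫ x, (G x).im ∂(Measure.pi μ) := (integral_im hGi).symm
  have r4 := (aux_bdd_diff c z.im⁻¹ n μ (fun x => (G x).re) (Complex.measurable_re.comp hGm)
    (fun x => (Complex.abs_re_le_norm _).trans (hGB x))
    (fun x k y => by
      rw [← Complex.sub_re]; exact (Complex.abs_re_le_norm _).trans (hGc x k y))).2
  have i4 := (aux_bdd_diff c z.im⁻¹ n μ (fun x => (G x).im) (Complex.measurable_im.comp hGm)
    (fun x => (Complex.abs_im_le_norm _).trans (hGB x))
    (fun x k y => by
      rw [← Complex.sub_im]; exact (Complex.abs_im_le_norm _).trans (hGc x k y))).2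
  rw [← hre] at r4
  rw [← him] at i4
  have hb : ∀ x, ‖G x - m‖ ≤ z.im⁻¹ + ‖m‖ := fun x =>
    (norm_sub_le _ _).trans (by linarith [hGB x])
  have hi1 : Integrable (fun x => ‖G x - m‖ ^ 4) (Measure.pi μ) :=
    aux_int _ ((hGm.sub_const m).norm.pow_const 4) (B := (z.im⁻¹ + ‖m‖) ^ 4) (fun x => by
      rw [abs_pow, abs_norm]; exact pow_le_pow_left₀ (norm_nonneg _) (hb x) 4)
  have hi2 : Integrable (fun x => ((G x).re - m.re) ^ 4) (Measure.pi μ) :=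
    aux_int _ (((Complex.measurable_re.comp hGm).sub_const _).pow_const 4)
      (B := (z.im⁻¹ + ‖m‖) ^ 4) (fun x => by
      rw [abs_pow, ← Complex.sub_re]
      exact pow_le_pow_left₀ (abs_nonneg _) ((Complex.abs_re_le_norm _).trans (hb x)) 4)
  have hi3 : Integrable (fun x => ((G x).im - m.im) ^ 4) (Measure.pi μ) :=
    aux_int _ (((Complex.measurable_im.comp hGm).sub_const _).pow_const 4)
      (B := (z.im⁻¹ + ‖m‖) ^ 4) (fun x => by
      rw [abs_pow, ← Complex.sub_im]
      exact pow_le_pow_left₀ (abs_nonneg _) ((Complex.abs_im_le_norm _).trans (hb x)) 4)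
  calc ∫ x, ‖G x - m‖ ^ 4 ∂(Measure.pi μ)
      ≤ ∫ x, 2 * (((G x).re - m.re) ^ 4 + ((G x).im - m.im) ^ 4) ∂(Measure.pi μ) := by
        refine integral_mono hi1 ((hi2.add hi3).const_mul 2) (fun x => ?_)
        have := aux_norm_four (G x - m)
        rwa [Complex.sub_re, Complex.sub_im] at this
    _ = 2 * (∫ x, ((G x).re - m.re) ^ 4 ∂(Measure.pi μ)
          + ∫ x, ((G x).im - m.im) ^ 4 ∂(Measure.pi μ)) := by
        rw [integral_const_mul, integral_add hi2 hi3]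
    _ ≤ 2 * (4 * (n : ℝ) ^ 2 * c ^ 4 + 4 * (n : ℝ) ^ 2 * c ^ 4) := by linarith
    _ = (4096 / z.im ^ 4) / (n : ℝ) ^ 2 := by
        rw [hcdef]
        rcases Nat.eq_zero_or_pos n with h0 | h0
        · subst h0; simp
        · have : (0 : ℝ) < n := by exact_mod_cast h0
          field_simp
          norm_num
end

section
/- Let K≥2 and C>0. Let X=(x_1,…,x_p) and Y=(y_1,…,y_p) be independent random vectors in ℝ^p, each having iid coordinates with mean 0 and satisfying E|x_j|^K ≤ C·p^{−K/2} and E|y_j|^K ≤ C·p^{−K/2}. Then there is a constant C′ depending only on K and C such that E|X^T Y|^K ≤ C′·p^{−K/2}. -/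
open MeasureTheory ProbabilityTheory

lemma scalar_bound (K : ℝ) (hK : 2 ≤ K) (t : ℝ) :
    |1 + t| ^ K ≤ 1 + K * t + (K ^ 2 + (1 + K) ^ K) * (t ^ 2 + |t| ^ K) := by
  have hK0 : 0 < K := by linarith
  have h1 : 0 ≤ (1 + K) ^ K := by positivity
  have h2 : 0 ≤ |t| ^ K := by positivity
  have h3 : 0 ≤ (1 + K) ^ K * t ^ 2 := by positivity
  have h4 : 0 ≤ (1 + K) ^ K * |t| ^ K := by positivity
  have h5 : 0 ≤ K ^ 2 * |t| ^ K := by positivity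
  by_cases ht : |K * t| ≤ 1
  · have h6 := (abs_le.1 (Real.abs_exp_sub_one_sub_id_le ht)).2
    have h7 : |t| ≤ 1 := by
      rw [abs_mul, abs_of_pos hK0] at ht
      nlinarith [abs_nonneg t]
    have h8 : 0 ≤ 1 + t := by linarith [(abs_le.1 h7).1]
    have h9 : |1 + t| ^ K ≤ Real.exp (K * t) := by
      rw [abs_of_nonneg h8, mul_comm, Real.exp_mul]
      apply Real.rpow_le_rpow h8 _ hK0.le
      linarith [Real.add_one_le_exp t]
    nlinarith
  · push Not at ht
    rw [abs_mul, abs_of_pos hK0] at ht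
    have h6 : |1 + t| ^ K ≤ (1 + K) ^ K * |t| ^ K := by
      rw [← Real.mul_rpow (by positivity) (abs_nonneg t)]
      apply Real.rpow_le_rpow (abs_nonneg _) _ hK0.le
      have := abs_add_le 1 t
      rw [abs_one] at this
      nlinarith
    have h7 : -(K * t) ≤ K ^ 2 * t ^ 2 := by
      have : -(K * t) ≤ K * |t| := by nlinarith [neg_abs_le t]
      have h8 : K ^ 2 * t ^ 2 = (K * |t|) * (K * |t|) := by
        rw [← sq_abs t]; ring
      nlinarith
    nlinarith

lemma pair_bound (K : ℝ) (hK : 2 ≤ K) (a b : ℝ) :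
    |a + b| ^ K ≤ |a| ^ K + K * (a * |a| ^ (K - 2)) * b
      + (K ^ 2 + (1 + K) ^ K) * (|a| ^ (K - 2) * b ^ 2 + |b| ^ K) := by
  have hK0 : 0 < K := by linarith
  by_cases ha : a = 0
  · subst ha
    have h1 : 1 ≤ (1 + K) ^ K := Real.one_le_rpow (by linarith) hK0.le
    have h2 : 0 ≤ |b| ^ K := by positivity
    have h3 : 0 ≤ (K ^ 2 + (1 + K) ^ K) * (|(0:ℝ)| ^ (K - 2) * b ^ 2) := by positivity
    simp only [zero_add, zero_mul, mul_zero, abs_zero] at *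
    rw [Real.zero_rpow hK0.ne']
    nlinarith [sq_nonneg K]
  · have hp : 0 < |a| := abs_pos.2 ha
    have h := mul_le_mul_of_nonneg_left (scalar_bound K hK (b / a)) (by positivity : 0 ≤ |a| ^ K)
    have e1 : |a| ^ K * |1 + b / a| ^ K = |a + b| ^ K := by
      rw [← Real.mul_rpow (abs_nonneg _) (abs_nonneg _), ← abs_mul]
      congr 2; field_simp
    have e2 : |a| ^ K * |b / a| ^ K = |b| ^ K := by
      rw [← Real.mul_rpow (abs_nonneg _) (abs_nonneg _), ← abs_mul]
      congr 2; field_simp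
    have e3 : |a| ^ K = |a| ^ (K - 2) * a ^ 2 := by
      rw [← sq_abs a, ← Real.rpow_natCast |a| 2, ← Real.rpow_add hp]; norm_num
    have e4 : |a| ^ K * (b / a) ^ 2 = |a| ^ (K - 2) * b ^ 2 := by
      rw [e3]; field_simp
    have e5 : |a| ^ K * (b / a) = (a * |a| ^ (K - 2)) * b := by
      rw [e3]; field_simp
    calc _ = _ := e1.symm
      _ ≤ _ := h
      _ = |a| ^ K + K * (|a| ^ K * (b / a)) + (K ^ 2 + (1 + K) ^ K) * (|a| ^ K * (b / a) ^ 2 + |a| ^ K * |b / a| ^ K) := by ring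
      _ = _ := by rw [e2, e4, e5]; ring

lemma young_bound (K : ℝ) (hK : 2 ≤ K) (e : ℝ) (he : 0 < e) (a b : ℝ) :
    |a| ^ (K - 2) * b ^ 2 ≤ e * |a| ^ K + e⁻¹ ^ (K / 2 - 1) * |b| ^ K := by
  have h1 : 0 ≤ e * |a| ^ K := by positivity
  have h2 : 0 ≤ e⁻¹ ^ (K / 2 - 1) * |b| ^ K := by positivity
  have key : ∀ x : ℝ, |x| ^ (K - 2) * x ^ 2 = |x| ^ K := by
    intro x
    by_cases hx : x = 0
    · subst hx; simp [Real.zero_rpow (by linarith : K ≠ 0)]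
    · rw [← sq_abs x, ← Real.rpow_natCast |x| 2, ← Real.rpow_add (abs_pos.2 hx)]; norm_num
  have key2 : ∀ x : ℝ, |x| ^ (K - 2) = (x ^ 2) ^ (K / 2 - 1) := by
    intro x
    rw [← sq_abs x, ← Real.rpow_natCast |x| 2, ← Real.rpow_mul (abs_nonneg _)]
    congr 1; push_cast; ring
  by_cases h : b ^ 2 ≤ e * a ^ 2
  · have := mul_le_mul_of_nonneg_left h (by positivity : 0 ≤ |a| ^ (K - 2))
    have := key a
    nlinarith
  · push Not at h
    have h3 : a ^ 2 ≤ e⁻¹ * b ^ 2 := by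
      rw [inv_mul_eq_div, le_div_iff₀ he]; linarith
    have h4 : |a| ^ (K - 2) ≤ e⁻¹ ^ (K / 2 - 1) * |b| ^ (K - 2) := by
      rw [key2 a, key2 b, ← Real.mul_rpow (by positivity) (by positivity)]
      exact Real.rpow_le_rpow (by positivity) h3 (by linarith)
    have h5 := mul_le_mul_of_nonneg_right h4 (sq_nonneg b)
    rw [mul_assoc, key b] at h5
    linarith

/-- combined pointwise inequality -/
lemma step_bound (K : ℝ) (hK : 2 ≤ K) : ∃ D : ℝ, 1 ≤ D ∧ ∀ n : ℝ, 1 ≤ n → ∀ a b : ℝ,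
    |a + b| ^ K ≤ |a| ^ K + K * (a * |a| ^ (K - 2)) * b
      + (1 / (2 * n)) * |a| ^ K + D * n ^ (K / 2 - 1) * |b| ^ K := by
  set c : ℝ := K ^ 2 + (1 + K) ^ K with hc
  have hc1 : 1 ≤ c := by
    have : 0 ≤ (1 + K) ^ K := Real.rpow_nonneg (by linarith) _
    nlinarith
  have hq : 0 ≤ (2 * c) ^ (K / 2 - 1) := by positivity
  refine ⟨c * ((2 * c) ^ (K / 2 - 1) + 1), by nlinarith, fun n hn a b => ?_⟩
  have h := pair_bound K hK a b
  rw [← hc] at h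
  have hy := young_bound K hK (1 / (2 * c * n)) (by positivity) a b
  have h1 : (1 / (2 * c * n))⁻¹ ^ (K / 2 - 1) = (2 * c) ^ (K / 2 - 1) * n ^ (K / 2 - 1) := by
    rw [one_div, inv_inv, Real.mul_rpow (by positivity) (by positivity)]
  rw [h1] at hy
  have h2 : 1 ≤ n ^ (K / 2 - 1) := Real.one_le_rpow hn (by linarith)
  have h3 : |b| ^ K ≤ n ^ (K / 2 - 1) * |b| ^ K := by
    have : 0 ≤ |b| ^ K := by positivity
    nlinarith
  have h4 := mul_le_mul_of_nonneg_left (add_le_add hy h3) (by positivity : 0 ≤ c)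
  have h5 : c * (1 / (2 * c * n) * |a| ^ K) = (1 / (2 * n)) * |a| ^ K := by
    field_simp
  calc _ ≤ _ := h
    _ ≤ _ := add_le_add_right h4 _
    _ = |a| ^ K + K * (a * |a| ^ (K - 2)) * b + c * (1 / (2 * c * n) * |a| ^ K) + c * ((2 * c) ^ (K / 2 - 1) + 1) * n ^ (K / 2 - 1) * |b| ^ K := by ring
    _ = _ := by rw [h5]

lemma integrable_abs_iff {Ω : Type} [MeasurableSpace Ω] {μ : Measure Ω} (K : ℝ) (hK : 2 ≤ K)
    {f : Ω → ℝ} (hf : AEStronglyMeasurable f μ) :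
    Integrable (fun ω => |f ω| ^ K) μ ↔ MemLp f (ENNReal.ofReal K) μ := by
  have h := integrable_norm_rpow_iff (p := ENNReal.ofReal K) hf
    (by simp; linarith) ENNReal.ofReal_ne_top
  rwa [ENNReal.toReal_ofReal (by linarith)] at h

lemma sum_moment (K : ℝ) (hK : 2 ≤ K) : ∃ A : ℝ, 1 ≤ A ∧
    ∀ (Ω : Type) [MeasurableSpace Ω] (μ : Measure Ω) [IsProbabilityMeasure μ] (ι : Type)
      (Z : ι → Ω → ℝ) (M : ℝ), (∀ i, Measurable (Z i)) →
      (∀ (s : Finset ι) (i : ι), i ∉ s → IndepFun (fun ω => ∑ j ∈ s, Z j ω) (Z i) μ) →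
      (∀ i, MemLp (Z i) (ENNReal.ofReal K) μ) → (∀ i, ∫ ω, Z i ω ∂μ = 0) →
      (∀ i, ∫ ω, |Z i ω| ^ K ∂μ ≤ M) → 0 ≤ M → ∀ s : Finset ι,
      ∫ ω, |∑ i ∈ s, Z i ω| ^ K ∂μ ≤ A * (s.card : ℝ) ^ (K / 2) * M := by
  obtain ⟨D, hD, hstep⟩ := step_bound K hK
  refine ⟨2 * D, by linarith, ?_⟩
  intro Ω _ μ _ ι Z M hm hind hLp hmean hM hM0 s
  have hK0 : 0 < K := by linarith
  classical
  induction s using Finset.induction_on with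
  | empty => simp [Real.zero_rpow hK0.ne', Real.zero_rpow (by linarith : K / 2 ≠ 0)]
  | insert i s hi ih =>
    rcases Finset.eq_empty_or_nonempty s with rfl | hs
    · have := hM i
      simp
      nlinarith
    set n : ℝ := (s.card : ℝ) with hn
    have hn1 : 1 ≤ n := by
      rw [hn]; exact_mod_cast hs.card_pos
    set S : Ω → ℝ := fun ω => ∑ j ∈ s, Z j ω with hS
    have hSm : Measurable S := Finset.measurable_sum _ (fun j _ => hm j)
    have hSLp : MemLp S (ENNReal.ofReal K) μ := memLp_finsetSum _ (fun j _ => hLp j)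
    have hSi : Integrable (fun ω => |S ω| ^ K) μ :=
      (integrable_abs_iff K hK hSm.aestronglyMeasurable).2 hSLp
    have hZi : Integrable (fun ω => |Z i ω| ^ K) μ :=
      (integrable_abs_iff K hK (hm i).aestronglyMeasurable).2 (hLp i)
    have hSZ : Integrable (fun ω => |S ω + Z i ω| ^ K) μ :=
      (integrable_abs_iff K hK (hSm.add (hm i)).aestronglyMeasurable).2 (hSLp.add (hLp i))
    have hindS : IndepFun S (Z i) μ := hind s i hi
    have hφm : Measurable (fun x : ℝ => x * |x| ^ (K - 2)) := by fun_prop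
    have hcross0 : ∫ ω, (S ω * |S ω| ^ (K - 2)) * Z i ω ∂μ = 0 := by
      have h := (hindS.comp hφm measurable_id).integral_fun_mul_eq_mul_integral
        (hφm.comp hSm).aestronglyMeasurable (hm i).aestronglyMeasurable
      simp only [Function.comp_def, id] at h
      rw [h, hmean i, mul_zero]
    have hcrossi : Integrable (fun ω => (S ω * |S ω| ^ (K - 2)) * Z i ω) μ := by
      refine (hSi.add hZi).mono' ((hφm.comp hSm).mul (hm i)).aestronglyMeasurable ?_
      filter_upwards with ω
      simp only [Pi.add_apply, Real.norm_eq_abs, abs_mul]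
      generalize S ω = a
      generalize Z i ω = b
      have ha0 := abs_nonneg a
      have hb0 := abs_nonneg b
      rw [abs_of_nonneg (Real.rpow_nonneg ha0 (K - 2))]
      have key : ∀ x : ℝ, 0 ≤ x → x * x ^ (K - 2) * x = x ^ K := by
        intro x hx
        rcases hx.eq_or_lt with rfl | hx
        · simp [Real.zero_rpow hK0.ne']
        · have : x ^ K = x ^ (K - 2) * x ^ (2 : ℝ) := by
            rw [← Real.rpow_add hx]; norm_num
          rw [this, Real.rpow_two]; ring
      have p1 := Real.rpow_nonneg ha0 K
      have p2 := Real.rpow_nonneg hb0 K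
      rcases le_total |a| |b| with hab | hab
      · have : |a| * |a| ^ (K - 2) * |b| ≤ |b| * |b| ^ (K - 2) * |b| := by
          gcongr
        rw [key _ hb0] at this
        linarith
      · have : |a| * |a| ^ (K - 2) * |b| ≤ |a| * |a| ^ (K - 2) * |a| := by
          gcongr
        rw [key _ ha0] at this
        linarith
    have hbound : ∫ ω, |S ω + Z i ω| ^ K ∂μ ≤
        ∫ ω, (((|S ω| ^ K + K * ((S ω * |S ω| ^ (K - 2)) * Z i ω))
          + (1 / (2 * n)) * |S ω| ^ K) + D * n ^ (K / 2 - 1) * |Z i ω| ^ K) ∂μ := by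
      refine integral_mono hSZ ?_ (fun ω => ?_)
      · exact (((hSi.add (hcrossi.const_mul K)).add (hSi.const_mul _)).add (hZi.const_mul _))
      · have := hstep n hn1 (S ω) (Z i ω)
        simp only
        linarith
    have i1 : Integrable (fun ω => |S ω| ^ K + K * ((S ω * |S ω| ^ (K - 2)) * Z i ω)) μ :=
      hSi.add (hcrossi.const_mul K)
    have i2 : Integrable (fun ω => |S ω| ^ K + K * ((S ω * |S ω| ^ (K - 2)) * Z i ω)
        + (1 / (2 * n)) * |S ω| ^ K) μ := i1.add (hSi.const_mul _)
    rw [integral_add i2 (hZi.const_mul _), integral_add i1 (hSi.const_mul _),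
      integral_add hSi (hcrossi.const_mul K), integral_const_mul, integral_const_mul,
      integral_const_mul, hcross0] at hbound
    have hins : ∀ ω, ∑ j ∈ insert i s, Z j ω = S ω + Z i ω := by
      intro ω; rw [Finset.sum_insert hi, add_comm]
    simp only [hins]
    rw [Finset.card_insert_of_notMem hi]
    push_cast
    rw [← hn]
    have hn0 : 0 < n := by linarith
    have hb : n ^ (K / 2) + n ^ (K / 2 - 1) ≤ (n + 1) ^ (K / 2) := by
      have h := one_add_mul_self_le_rpow_one_add (s := 1 / n) (by
        have : 0 ≤ 1 / n := by positivity
        linarith) (p := K / 2) (by linarith)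
      have e1 : n + 1 = n * (1 + 1 / n) := by field_simp
      rw [e1, Real.mul_rpow hn0.le (by positivity), Real.rpow_sub_one hn0.ne']
      have h2 : 1 + 1 / n ≤ (1 + 1 / n) ^ (K / 2) := by
        refine le_trans ?_ h
        have : 0 ≤ 1 / n := by positivity
        nlinarith
      have h3 := mul_le_mul_of_nonneg_left h2 (by positivity : 0 ≤ n ^ (K / 2))
      calc _ = n ^ (K / 2) * (1 + 1 / n) := by ring
        _ ≤ _ := h3
    have e2 : n ^ (K / 2) = n ^ (K / 2 - 1) * n := by
      rw [Real.rpow_sub_one hn0.ne']; field_simp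
    set q := n ^ (K / 2 - 1) with hq
    have hq0 : 0 ≤ q := by positivity
    have t1 : 1 / (2 * n) * ∫ ω, |S ω| ^ K ∂μ ≤ D * q * M := by
      calc _ ≤ 1 / (2 * n) * (2 * D * n ^ (K / 2) * M) := by gcongr
        _ = _ := by rw [e2]; field_simp
    have t2 : D * q * ∫ ω, |Z i ω| ^ K ∂μ ≤ D * q * M := by
      gcongr; exact hM i
    calc _ ≤ _ := hbound
      _ ≤ 2 * D * n ^ (K / 2) * M + D * q * M + D * q * M := by linarith
      _ = 2 * D * (n ^ (K / 2) + q) * M := by ring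
      _ ≤ _ := by gcongr

lemma memLp_of_add {Ω : Type} [MeasurableSpace Ω] {μ : Measure Ω} [IsProbabilityMeasure μ]
    (K : ℝ) (hK : 2 ≤ K) {R Z : Ω → ℝ} (hR : Measurable R) (hZ : Measurable Z)
    (hind : IndepFun R Z μ) (h : MemLp (fun ω => R ω + Z ω) (ENNReal.ofReal K) μ) :
    MemLp Z (ENNReal.ofReal K) μ := by
  have hi := (integrable_abs_iff K hK h.1).2 h
  have hmap := (indepFun_iff_map_prod_eq_prod_map_map hR.aemeasurable hZ.aemeasurable).1 hind
  have := Measure.isProbabilityMeasure_map (μ := μ) hR.aemeasurable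
  have := Measure.isProbabilityMeasure_map (μ := μ) hZ.aemeasurable
  have hg : Measurable (fun q : ℝ × ℝ => |q.1 + q.2| ^ K) := by fun_prop
  have h1 : Integrable (fun q : ℝ × ℝ => |q.1 + q.2| ^ K) ((μ.map R).prod (μ.map Z)) := by
    rw [← hmap, integrable_map_measure hg.aestronglyMeasurable (hR.prodMk hZ).aemeasurable]
    exact hi
  obtain ⟨r, hr⟩ := h1.prod_right_ae.exists
  have h2 : Integrable (fun ω => |r + Z ω| ^ K) μ :=
    (integrable_map_measure (hg.comp measurable_prodMk_left).aestronglyMeasurable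
      hZ.aemeasurable).1 hr
  have h3 := (integrable_abs_iff K hK (by fun_prop)).1 h2
  have h4 := h3.sub (memLp_const r)
  convert h4 using 1
  ext ω; simp

lemma indep_pairs {Ω : Type} [MeasurableSpace Ω] {μ : Measure Ω} {p : ℕ}
    {X Y : Ω → Fin p → ℝ} (hX : Measurable X) (hY : Measurable Y)
    (hind : iIndepFun
          (fun s : Fin p ⊕ Fin p => Sum.elim (fun j ω => X ω j) (fun j ω => Y ω j) s) μ)
    (s : Finset (Fin p)) (i : Fin p) (hi : i ∉ s) :
    IndepFun (fun ω => ∑ j ∈ s, X ω j * Y ω j) (fun ω => X ω i * Y ω i) μ := by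
  classical
  have hd : Disjoint (s.disjSum s) (({i} : Finset (Fin p)).disjSum {i}) := by
    rw [Finset.disjoint_left]
    rintro (j | j) h1 h2 <;> simp at h1 h2 <;> subst h2 <;> exact hi h1
  have h := hind.indepFun_finset _ _ hd (by
    rintro (j | j)
    · exact (measurable_pi_apply j).comp hX
    · exact (measurable_pi_apply j).comp hY)
  let φ : ∀ t : Finset (Fin p), ({k // k ∈ t.disjSum t} → ℝ) → ℝ := fun t v =>
    ∑ j : t, v ⟨Sum.inl j, by simp⟩ * v ⟨Sum.inr j, by simp⟩
  have hφ : ∀ t, Measurable (φ t) := by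
    intro t
    refine Finset.measurable_sum _ (fun j _ => ?_)
    exact (measurable_pi_apply _).mul (measurable_pi_apply _)
  have h2 := h.comp (hφ s) (hφ {i})
  have e : ∀ (t : Finset (Fin p)) (ω : Ω), ∑ j ∈ t, X ω j * Y ω j = φ t (fun k =>
      Sum.elim (fun j ω => X ω j) (fun j ω => Y ω j) k.1 ω) := by
    intro t ω
    exact (Finset.sum_coe_sort t (fun j => X ω j * Y ω j)).symm
  convert h2 using 1
  · ext ω; exact e s ω
  · ext ω; rw [← Finset.sum_singleton (fun j => X ω j * Y ω j) i]; exact e {i} ω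



/-- Moment bound for the inner product of independent random vectors with iid centered
coordinates: if `E|x_j|^K ≤ C p^{−K/2}` and `E|y_j|^K ≤ C p^{−K/2}` with `K ≥ 2`, then
`E|X^T Y|^K ≤ C′ p^{−K/2}` for a constant `C′` depending only on `K` and `C`. -/
theorem inner_product_moment_bound (K C : ℝ) (hK : 2 ≤ K) (hC : 0 < C) :
    ∃ C' : ℝ, 0 < C' ∧
      ∀ (Ω : Type) [MeasureSpace Ω] [IsProbabilityMeasure (ℙ : Measure Ω)]
        (p : ℕ) (X Y : Ω → Fin p → ℝ),
        Measurable X → Measurable Y →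
        -- all the coordinates of X and of Y are jointly independent
        iIndepFun
          (fun s : Fin p ⊕ Fin p => Sum.elim (fun j ω => X ω j) (fun j ω => Y ω j) s) ℙ →
        -- the coordinates of X are identically distributed, and likewise for Y
        (∀ j j' : Fin p, IdentDistrib (fun ω => X ω j) (fun ω => X ω j') ℙ ℙ) →
        (∀ j j' : Fin p, IdentDistrib (fun ω => Y ω j) (fun ω => Y ω j') ℙ ℙ) →
        -- mean zero
        (∀ j, ∫ ω, X ω j ∂(ℙ : Measure Ω) = 0) →
        (∀ j, ∫ ω, Y ω j ∂(ℙ : Measure Ω) = 0) →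
        -- K-th moment bounds
        (∀ j, ∫ ω, |X ω j| ^ K ∂(ℙ : Measure Ω) ≤ C * (p : ℝ) ^ (-(K / 2))) →
        (∀ j, ∫ ω, |Y ω j| ^ K ∂(ℙ : Measure Ω) ≤ C * (p : ℝ) ^ (-(K / 2))) →
        ∫ ω, |∑ j, X ω j * Y ω j| ^ K ∂(ℙ : Measure Ω) ≤ C' * (p : ℝ) ^ (-(K / 2)) := by
  obtain ⟨A, hA, hmain⟩ := sum_moment K hK
  refine ⟨A * C ^ 2, by positivity, ?_⟩
  intro Ω _ _ p X Y hX hY hind hidX hidY hmX hmY hKX hKY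
  have hK0 : 0 < K := by linarith
  have hXj : ∀ j, Measurable (fun ω => X ω j) := fun j => (measurable_pi_apply j).comp hX
  have hYj : ∀ j, Measurable (fun ω => Y ω j) := fun j => (measurable_pi_apply j).comp hY
  have hZj : ∀ j, Measurable (fun ω => X ω j * Y ω j) := fun j => (hXj j).mul (hYj j)
  have hXY : ∀ j, IndepFun (fun ω => X ω j) (fun ω => Y ω j) (ℙ : Measure Ω) := fun j =>
    hind.indepFun (i := Sum.inl j) (j := Sum.inr j) (by simp)
  have hRHS : 0 ≤ A * C ^ 2 * (p : ℝ) ^ (-(K / 2)) := by positivity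
  have hpairs := indep_pairs hX hY hind
  by_cases hint : Integrable (fun ω => |∑ j, X ω j * Y ω j| ^ K) (ℙ : Measure Ω)
  swap
  · rw [integral_undef hint]; exact hRHS
  have hSm : Measurable (fun ω => ∑ j, X ω j * Y ω j) :=
    Finset.measurable_sum _ (fun j _ => hZj j)
  have hSLp := (integrable_abs_iff K hK hSm.aestronglyMeasurable).1 hint
  have hZLp : ∀ j, MemLp (fun ω => X ω j * Y ω j) (ENNReal.ofReal K) (ℙ : Measure Ω) := by
    intro j
    refine memLp_of_add K hK (Finset.measurable_sum _ (fun k _ => hZj k)) (hZj j)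
      (hpairs (Finset.univ.erase j) j (by simp)) ?_
    convert hSLp using 2 with ω
    exact Finset.sum_erase_add _ _ (Finset.mem_univ j)
  rcases Nat.eq_zero_or_pos p with rfl | hp
  · simpa [Real.zero_rpow hK0.ne'] using hRHS
  have hp0 : (0 : ℝ) < p := by exact_mod_cast hp
  have hM : ∀ j, ∫ ω, |X ω j * Y ω j| ^ K ∂(ℙ : Measure Ω) ≤ (C * (p : ℝ) ^ (-(K / 2))) ^ 2 := by
    intro j
    have hφ : Measurable (fun x : ℝ => |x| ^ K) := by fun_prop
    have h := ((hXY j).comp hφ hφ).integral_fun_mul_eq_mul_integral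
      (hφ.comp (hXj j)).aestronglyMeasurable (hφ.comp (hYj j)).aestronglyMeasurable
    simp only [Function.comp_def] at h
    simp only [abs_mul, Real.mul_rpow (abs_nonneg _) (abs_nonneg _)]
    rw [h, sq]
    exact mul_le_mul (hKX j) (hKY j) (integral_nonneg fun ω => by positivity) (by positivity)
  have hmean : ∀ j, ∫ ω, X ω j * Y ω j ∂(ℙ : Measure Ω) = 0 := by
    intro j
    rw [(hXY j).integral_fun_mul_eq_mul_integral (hXj j).aestronglyMeasurable
      (hYj j).aestronglyMeasurable, hmX j, zero_mul]
  have h := hmain Ω ℙ (Fin p) (fun j ω => X ω j * Y ω j) _ hZj hpairs hZLp hmean hM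
    (by positivity) Finset.univ
  refine h.trans (le_of_eq ?_)
  rw [Finset.card_univ, Fintype.card_fin, mul_pow, sq ((p : ℝ) ^ (-(K / 2))),
    Real.rpow_neg hp0.le]
  have : (p : ℝ) ^ (K / 2) ≠ 0 := by positivity
  field_simp
end
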